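/- Let n ≥ 1 and let H : ℝⁿ × ℝⁿ → ℝ be continuous and satisfy (H1), (H2), (H3c) and (H4). For each k ∈ ℕ let u_k be the unique Lipschitz state-constraint viscosity solution of u_k(x) + H(x, Du_k(x)) = 0 on Ω_k = B(0,k), and let u be the unique bounded Lipschitz viscosity solution of u(x) + H(x, Du(x)) = 0 in ℝⁿ. Then: (i) u(x) ≤ u_k(x) for every x in the closure of B(0,k); and (ii) there exists a constant C > 0 depending only on H such that 0 ≤ u_k(x) − u(x) ≤ C(1 + |x|²)/k² for all k ≥ 2 and all x ∈ B(0,k). In particular, for any fixed R > 0, 0 ≤ u_k(x) − u(x) ≤ C(1 + R²)/k² for all x with |x| ≤ R. -/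

import Mathlib

open Metric Set MeasureTheory Filter
open scoped Topology NNReal RealInnerProductSpace

noncomputable section

abbrev Euc (n : ℕ) := EuclideanSpace ℝ (Fin n)

/-- `v` is a viscosity subsolution of `v + H(x, Dv) = 0` in the open set `Ω`. -/
def IsViscositySubsolutionIn {n : ℕ} (Ω : Set (Euc n)) (H : Euc n → Euc n → ℝ)
    (v : Euc n → ℝ) : Prop :=
  ∀ x ∈ Ω, ∀ φ : Euc n → ℝ, ContDiff ℝ 1 φ →
    IsLocalMaxOn (fun y => v y - φ y) Ω x → v x + H x (gradient φ x) ≤ 0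

/-- `v` is a viscosity supersolution of `v + H(x, Dv) = 0` on the closure of `Ω`. -/
def IsViscositySupersolutionOn {n : ℕ} (Ω : Set (Euc n)) (H : Euc n → Euc n → ℝ)
    (v : Euc n → ℝ) : Prop :=
  ∀ x ∈ closure Ω, ∀ φ : Euc n → ℝ, ContDiff ℝ 1 φ →
    IsLocalMinOn (fun y => v y - φ y) (closure Ω) x → 0 ≤ v x + H x (gradient φ x)

/-- `v` is a state-constraint viscosity solution on `Ω`. -/
def IsStateConstraintSolution {n : ℕ} (Ω : Set (Euc n)) (H : Euc n → Euc n → ℝ)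
    (v : Euc n → ℝ) : Prop :=
  ContinuousOn v (closure Ω) ∧ IsViscositySubsolutionIn Ω H v ∧
    IsViscositySupersolutionOn Ω H v

lemma quad_contDiff {n : ℕ} (α β c : ℝ) (a : Euc n) :
    ContDiff ℝ 1 (fun x : Euc n => α * ‖x‖ ^ 2 + β * ‖x - a‖ ^ 2 + c) := by
  have h1 : ContDiff ℝ 1 (fun x : Euc n => ‖x‖ ^ 2) := contDiff_id.norm_sq ℝ
  have h2 : ContDiff ℝ 1 (fun x : Euc n => ‖x - a‖ ^ 2) :=
    (contDiff_id.sub contDiff_const).norm_sq ℝ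
  exact ((contDiff_const.mul h1).add (contDiff_const.mul h2)).add contDiff_const

lemma quad_gradient {n : ℕ} (α β c : ℝ) (a x : Euc n) :
    gradient (fun x : Euc n => α * ‖x‖ ^ 2 + β * ‖x - a‖ ^ 2 + c) x
      = (2 * α) • x + (2 * β) • (x - a) := by
  apply HasGradientAt.gradient
  rw [hasGradientAt_iff_hasFDerivAt]
  have h1 := (hasFDerivAt_id (𝕜 := ℝ) x).norm_sq
  have h2 := ((hasFDerivAt_id (𝕜 := ℝ) x).sub_const a).norm_sq
  have h3 := ((h1.const_mul α).add (h2.const_mul β)).add_const c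
  refine h3.congr_fderiv ?_
  ext v
  simp [inner_add_left, inner_smul_left, inner_sub_left]
  ring

lemma doubling {n : ℕ} (S : Set (Euc n)) (hS : IsCompact S) (hne : S.Nonempty)
    (f g : Euc n → ℝ) (hf : ContinuousOn f S) (L : ℝ≥0) (hg : LipschitzWith L g)
    (ε : ℝ) (hε : 0 < ε) :
    ∃ x₀ ∈ S, ∃ y₀ : Euc n, ‖x₀ - y₀‖ ≤ 2 * L * ε ∧
      ∀ x ∈ S, ∀ y, f x + g y - (1 / (2 * ε)) * ‖x - y‖ ^ 2
        ≤ f x₀ + g y₀ - (1 / (2 * ε)) * ‖x₀ - y₀‖ ^ 2 := by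
  have hL : (0 : ℝ) ≤ L := L.2
  have hr : 0 ≤ 2 * (L : ℝ) * ε := by positivity
  have hcomp : IsCompact (S ×ˢ closedBall (0 : Euc n) (2 * L * ε)) :=
    hS.prod (isCompact_closedBall _ _)
  have hcont : ContinuousOn
      (fun q : Euc n × Euc n => f q.1 + g (q.1 + q.2) - (1 / (2 * ε)) * ‖q.2‖ ^ 2)
      (S ×ˢ closedBall (0 : Euc n) (2 * L * ε)) := by
    have h1 : ContinuousOn (fun q : Euc n × Euc n => f q.1)
        (S ×ˢ closedBall (0 : Euc n) (2 * L * ε)) :=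
      hf.comp continuousOn_fst (fun q hq => hq.1)
    have hgc := hg.continuous
    have h2 : Continuous (fun q : Euc n × Euc n => g (q.1 + q.2)) := by fun_prop
    have h3 : Continuous (fun q : Euc n × Euc n => (1 / (2 * ε)) * ‖q.2‖ ^ 2) := by fun_prop
    exact (h1.add h2.continuousOn).sub h3.continuousOn
  obtain ⟨w, hw⟩ := hne
  obtain ⟨⟨x₀, z₀⟩, ⟨hx₀, hz₀⟩, hmax⟩ := hcomp.exists_isMaxOn
    ⟨(w, 0), hw, by simpa using hr⟩ hcont
  simp only [mem_closedBall, dist_zero_right] at hz₀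
  refine ⟨x₀, hx₀, x₀ + z₀, by simpa using hz₀, ?_⟩
  intro x hx y
  have key : ∀ z : Euc n, ‖z‖ ≤ 2 * L * ε →
      f x + g (x + z) - (1 / (2 * ε)) * ‖z‖ ^ 2
        ≤ f x₀ + g (x₀ + z₀) - (1 / (2 * ε)) * ‖z₀‖ ^ 2 := fun z hz =>
    hmax (show (x, z) ∈ _ from ⟨hx, by simpa using hz⟩)
  have e : ‖x₀ - (x₀ + z₀)‖ = ‖z₀‖ := by simp
  rw [e]
  by_cases hy : ‖x - y‖ ≤ 2 * L * ε
  · have := key (y - x) (by rwa [norm_sub_rev])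
    rw [norm_sub_rev y x] at this
    simpa using this
  · push Not at hy
    have h0 := key 0 (by simpa using hr)
    have hl := hg.dist_le_mul y x
    rw [dist_eq_norm, dist_eq_norm, norm_sub_rev y x, Real.norm_eq_abs] at hl
    have hl' := (abs_le.1 hl).2
    have : (L : ℝ) * ‖x - y‖ ≤ (1 / (2 * ε)) * ‖x - y‖ ^ 2 := by
      rw [one_div, ← div_eq_inv_mul, le_div_iff₀ (by positivity)]
      nlinarith [norm_nonneg (x - y)]
    simp at h0
    simp only [one_div, mul_inv_rev] at *
    linarith

lemma lower_bound {n : ℕ} (H : Euc n → Euc n → ℝ)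
    (hH3c : ∀ R > (0:ℝ), ∃ C > (0:ℝ), ∀ x y p q : Euc n, ‖p‖ ≤ R → ‖q‖ ≤ R →
      |H x p - H y p| ≤ C * ‖x - y‖ ∧ |H x p - H x q| ≤ C * ‖p - q‖)
    (Ω : Set (Euc n)) (hΩ : IsCompact (closure Ω)) (v u : Euc n → ℝ)
    (hv : ContinuousOn v (closure Ω)) (hsup : IsViscositySupersolutionOn Ω H v)
    (L : ℝ≥0) (hu : LipschitzWith L u) (hsub : IsViscositySubsolutionIn univ H u)
    (x : Euc n) (hx : x ∈ closure Ω) : u x ≤ v x := by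
  have hL : (0 : ℝ) ≤ L := L.2
  obtain ⟨C, hC, hHC⟩ := hH3c (2 * L + 1) (by positivity)
  apply le_of_forall_pos_le_add
  intro δ hδ
  obtain ⟨ε, hε, hεδ⟩ : ∃ ε > 0, C * (2 * L * ε) ≤ δ := by
    refine ⟨δ / (C * (2 * L + 1)), by positivity, ?_⟩
    rw [show C * (2 * L * (δ / (C * (2 * L + 1)))) = δ * ((2 * L) / (2 * L + 1)) by
      field_simp]
    have : (2 * (L:ℝ)) / (2 * L + 1) ≤ 1 := by rw [div_le_one (by positivity)]; linarith
    nlinarith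
  obtain ⟨y₀, hy₀, x₀, hxy, hmax⟩ := doubling (closure Ω) hΩ ⟨x, hx⟩ (fun y => - v y) u hv.neg L
    hu ε hε
  have h1 := hsub x₀ (mem_univ _) _ (quad_contDiff 0 (1 / (2 * ε)) 0 y₀) (by
    apply IsMaxOn.localize
    intro z _
    have := hmax y₀ hy₀ z
    simp only [norm_sub_rev y₀] at this
    simp only [mem_setOf_eq]
    linarith)
  have h2 := hsup y₀ hy₀ _ (quad_contDiff 0 (-(1 / (2 * ε))) 0 x₀) (by
    apply IsMinOn.localize
    intro z hz
    have := hmax z hz x₀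
    simp only [mem_setOf_eq]
    linarith)
  rw [quad_gradient] at h1 h2
  have ep : (2 * 0 : ℝ) • y₀ + (2 * -(1 / (2 * ε))) • (y₀ - x₀)
      = (2 * 0 : ℝ) • x₀ + (2 * (1 / (2 * ε))) • (x₀ - y₀) := by
    simp only [mul_zero, zero_smul, zero_add, mul_neg, neg_smul, ← smul_neg, neg_sub]
  rw [ep] at h2
  set p := (2 * 0 : ℝ) • x₀ + (2 * (1 / (2 * ε))) • (x₀ - y₀) with hp
  have hpn : ‖p‖ ≤ 2 * L + 1 := by
    have : ‖p‖ = ‖y₀ - x₀‖ / ε := by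
      rw [hp, mul_zero, zero_smul, zero_add, norm_smul, norm_sub_rev, Real.norm_eq_abs,
        abs_of_pos (by positivity)]
      field_simp
    rw [this, div_le_iff₀ hε]
    nlinarith
  have h3 := (abs_le.1 (hHC y₀ x₀ p p hpn hpn).1).2
  have h4 := hmax x hx x
  have h5 : 0 ≤ (1 / (2 * ε)) * ‖y₀ - x₀‖ ^ 2 := by positivity
  have h6 : C * ‖y₀ - x₀‖ ≤ C * (2 * L * ε) := by gcongr
  simp only [sub_self, norm_zero] at h4
  linarith

lemma upper_const {n : ℕ} (H : Euc n → Euc n → ℝ)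
    (C₁ : ℝ) (hH1 : ∀ x p : Euc n, -H x p ≤ C₁)
    (r : ℝ) (hr : 0 < r) (v : Euc n → ℝ) (hv : ContinuousOn v (closedBall 0 r))
    (L : ℝ≥0) (hL : LipschitzOnWith L v (closedBall 0 r))
    (hsub : IsViscositySubsolutionIn (ball 0 r) H v)
    (x : Euc n) (hx : x ∈ closedBall (0 : Euc n) r) : v x ≤ C₁ := by
  have hL0 : (0 : ℝ) ≤ L := L.2
  have hint : ∀ x ∈ ball (0 : Euc n) r, v x ≤ C₁ := by
    intro x hx
    have hxc := ball_subset_closedBall hx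
    rw [mem_ball_zero_iff] at hx
    obtain ⟨β, hβ, hβL⟩ : ∃ β > 0, (L : ℝ) < β * (r - ‖x‖) :=
      ⟨(L + 1) / (r - ‖x‖), div_pos (by positivity) (by linarith), by
        rw [div_mul_cancel₀ _ (by linarith)]; linarith⟩
    have hc : Continuous (fun y : Euc n => β * ‖y - x‖ ^ 2) := by fun_prop
    obtain ⟨y, hy, hmax⟩ := (isCompact_closedBall (0 : Euc n) r).exists_isMaxOn ⟨x, hxc⟩
      (hv.sub hc.continuousOn)
    have h0 : v x - β * ‖x - x‖ ^ 2 ≤ v y - β * ‖y - x‖ ^ 2 := hmax hxc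
    simp only [sub_self, norm_zero] at h0
    have hl := hL.dist_le_mul y hy x hxc
    rw [dist_eq_norm, dist_eq_norm, Real.norm_eq_abs] at hl
    have hl' := (abs_le.1 hl).2
    have hyb : y ∈ ball (0 : Euc n) r := by
      rw [mem_ball_zero_iff]
      by_contra hcon
      push Not at hcon
      have h1 : r - ‖x‖ ≤ ‖y - x‖ := by linarith [norm_sub_norm_le y x]
      have h2 : (L : ℝ) < β * ‖y - x‖ := lt_of_lt_of_le hβL (by gcongr)
      have h3 : 0 < ‖y - x‖ := by linarith
      nlinarith
    have h1 := hsub y hyb _ (quad_contDiff 0 β 0 x) (by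
      apply IsMaxOn.localize
      intro z hz
      have : v z - β * ‖z - x‖ ^ 2 ≤ v y - β * ‖y - x‖ ^ 2 := hmax (ball_subset_closedBall hz)
      simp only [mem_setOf_eq]
      linarith)
    have h2 := hH1 y (gradient (fun x_1 => 0 * ‖x_1‖ ^ 2 + β * ‖x_1 - x‖ ^ 2 + 0) y)
    have h3 : 0 ≤ β * ‖y - x‖ ^ 2 := by positivity
    linarith
  rw [← closure_ball _ hr.ne'] at hx hv
  exact le_on_closure hint hv continuousOn_const hx

lemma upper_bound {n : ℕ} (H : Euc n → Euc n → ℝ)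
    (C : ℝ) (hC : 0 < C) (M K : ℝ) (hK : 0 < K) (C₁ : ℝ) (hKe : C₁ + M ≤ K)
    (u : Euc n → ℝ) (hubd : ∀ x, |u x| ≤ M) (L : ℝ≥0) (hu : LipschitzWith L u)
    (hHC : ∀ x y p q : Euc n, ‖p‖ ≤ 2 * L + 2 * K → ‖q‖ ≤ 2 * L + 2 * K →
      |H x p - H y p| ≤ C * ‖x - y‖ ∧ |H x p - H x q| ≤ C * ‖p - q‖)
    (hsup : IsViscositySupersolutionOn univ H u)
    (r : ℝ) (hr : 1 ≤ r) (v : Euc n → ℝ) (hv : ContinuousOn v (closedBall 0 r))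
    (hvC : ∀ x ∈ closedBall (0 : Euc n) r, v x ≤ C₁)
    (hsub : IsViscositySubsolutionIn (ball 0 r) H v)
    (x : Euc n) (hx : x ∈ closedBall (0 : Euc n) r) :
    v x - u x ≤ K / r ^ 2 * ‖x‖ ^ 2 + K / r ^ 2 * C ^ 2 := by
  have hL : (0 : ℝ) ≤ L := L.2
  have hr0 : 0 < r := by linarith
  apply le_of_forall_pos_le_add
  intro δ hδ
  obtain ⟨ε, hε, hεδ⟩ : ∃ ε > 0, C * (2 * L * ε) ≤ δ := by
    refine ⟨δ / (C * (2 * L + 1)), by positivity, ?_⟩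
    rw [show C * (2 * L * (δ / (C * (2 * L + 1)))) = δ * ((2 * L) / (2 * L + 1)) by
      field_simp]
    have : (2 * (L:ℝ)) / (2 * L + 1) ≤ 1 := by rw [div_le_one (by positivity)]; linarith
    nlinarith
  set α := K / r ^ 2 with hα
  have hα0 : 0 < α := by positivity
  have hαr : α * r ^ 2 = K := by rw [hα]; field_simp
  have hfc : ContinuousOn (fun y => v y - (α * ‖y‖ ^ 2 + α * C ^ 2)) (closedBall 0 r) :=
    hv.sub (by fun_prop)
  obtain ⟨x₀, hx₀, y₀, hxy, hmax⟩ := doubling (closedBall 0 r) (isCompact_closedBall _ _) ⟨x, hx⟩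
    _ (fun y => - u y) hfc L hu.neg ε hε
  have h4 := hmax x hx x
  have h5 : 0 ≤ (1 / (2 * ε)) * ‖x₀ - y₀‖ ^ 2 := by positivity
  simp only [sub_self, norm_zero] at h4
  suffices hs : v x₀ - u y₀ ≤ α * ‖x₀‖ ^ 2 + α * C ^ 2 + δ by linarith
  rw [mem_closedBall_zero_iff] at hx₀
  rcases lt_or_eq_of_le hx₀ with hlt | heq
  · have h1 := hsub x₀ (mem_ball_zero_iff.2 hlt) _ (quad_contDiff α (1 / (2 * ε)) 0 y₀) (by
      apply IsMaxOn.localize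
      intro z hz
      have := hmax z (ball_subset_closedBall hz) y₀
      simp only [mem_setOf_eq]
      linarith)
    have h2 := hsup y₀ (by simp) _ (quad_contDiff 0 (-(1 / (2 * ε))) 0 x₀) (by
      apply IsMinOn.localize
      intro z hz
      have := hmax x₀ (mem_closedBall_zero_iff.2 hx₀) z
      simp only [norm_sub_rev x₀] at this
      simp only [mem_setOf_eq]
      linarith)
    rw [quad_gradient] at h1 h2
    have ep : (2 * 0 : ℝ) • y₀ + (2 * -(1 / (2 * ε))) • (y₀ - x₀)
        = (2 * (1 / (2 * ε))) • (x₀ - y₀) := by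
      simp only [mul_zero, zero_smul, zero_add, mul_neg, neg_smul, ← smul_neg, neg_sub]
    rw [ep] at h2
    set p := (2 * (1 / (2 * ε))) • (x₀ - y₀) with hp
    have hpn : ‖p‖ ≤ 2 * L := by
      have : ‖p‖ = ‖x₀ - y₀‖ / ε := by
        rw [hp, norm_smul, Real.norm_eq_abs, abs_of_pos (by positivity)]
        field_simp
      rw [this, div_le_iff₀ hε]
      exact hxy
    have hgn : ‖(2 * α) • x₀‖ = 2 * α * ‖x₀‖ := by
      rw [norm_smul, Real.norm_eq_abs, abs_of_pos (by positivity)]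
    have hgK : 2 * α * ‖x₀‖ ≤ 2 * K := by
      have : ‖x₀‖ ≤ r ^ 2 := by nlinarith
      nlinarith
    have hqn : ‖(2 * α) • x₀ + p‖ ≤ 2 * L + 2 * K :=
      (norm_add_le _ _).trans (by rw [hgn]; linarith)
    have hpn' : ‖p‖ ≤ 2 * L + 2 * K := by linarith
    have h3 := (abs_le.1 (hHC x₀ y₀ p p hpn' hpn').1).1
    have h3' := (abs_le.1 (hHC x₀ x₀ _ p hqn hpn').2).1
    rw [add_sub_cancel_right, hgn] at h3'
    have h6 : C * ‖x₀ - y₀‖ ≤ C * (2 * L * ε) := by gcongr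
    have h7 : 0 ≤ α * (‖x₀‖ - C) ^ 2 := by positivity
    nlinarith
  · have a1 := hvC x₀ (mem_closedBall_zero_iff.2 hx₀)
    have a2 := (abs_le.1 (hubd y₀)).1
    rw [heq, hαr]
    have : 0 ≤ α * C ^ 2 := by positivity
    linarith

/-- Theorem 1.1: rate of convergence `O(1/k²)` for general Hamiltonians on nested balls
`Ω_k = B(0,k)` exhausting `ℝⁿ`. -/
theorem rate_one_over_k_sq {n : ℕ} (hn : 1 ≤ n)
    (H : Euc n → Euc n → ℝ) (hHcont : Continuous (Function.uncurry H))
    (C₁ : ℝ) (hC₁ : 0 < C₁) (hH1 : ∀ x p : Euc n, -H x p ≤ C₁)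
    (C₂ : ℝ) (hC₂ : 0 < C₂) (hH2 : ∀ x : Euc n, |H x 0| ≤ C₂)
    (hH3c : ∀ R > (0:ℝ), ∃ C > (0:ℝ), ∀ x y p q : Euc n, ‖p‖ ≤ R → ‖q‖ ≤ R →
      |H x p - H y p| ≤ C * ‖x - y‖ ∧ |H x p - H x q| ≤ C * ‖p - q‖)
    (hH4 : ∀ M : ℝ, ∃ R : ℝ, ∀ p : Euc n, R ≤ ‖p‖ → ∀ x : Euc n, M ≤ H x p)
    (uk : ℕ → Euc n → ℝ) (Lip : ℝ≥0)
    (huk : ∀ k : ℕ, 1 ≤ k →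
      IsStateConstraintSolution (ball (0 : Euc n) (k : ℝ)) H (uk k) ∧
      LipschitzOnWith Lip (uk k) (closure (ball (0 : Euc n) (k : ℝ))))
    (u : Euc n → ℝ) (M : ℝ) (hubd : ∀ x, |u x| ≤ M) (Lip' : ℝ≥0)
    (hulip : LipschitzWith Lip' u)
    (husol : IsViscositySubsolutionIn univ H u ∧ IsViscositySupersolutionOn univ H u) :
    (∀ k : ℕ, 1 ≤ k → ∀ x ∈ closure (ball (0 : Euc n) (k : ℝ)), u x ≤ uk k x) ∧
    ∃ C > (0:ℝ),
      (∀ k : ℕ, 2 ≤ k → ∀ x ∈ ball (0 : Euc n) (k : ℝ),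
        0 ≤ uk k x - u x ∧ uk k x - u x ≤ C * (1 + ‖x‖ ^ 2) / (k : ℝ) ^ 2) ∧
      (∀ R > (0:ℝ), ∀ k : ℕ, 2 ≤ k → R < (k : ℝ) → ∀ x : Euc n, ‖x‖ ≤ R →
        0 ≤ uk k x - u x ∧ uk k x - u x ≤ C * (1 + R ^ 2) / (k : ℝ) ^ 2) := by
  have hM : 0 ≤ M := (abs_nonneg _).trans (hubd 0)
  have hlow : ∀ k : ℕ, 1 ≤ k → ∀ x ∈ closure (ball (0 : Euc n) (k : ℝ)), u x ≤ uk k x := by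
    intro k hk x hx
    obtain ⟨⟨hc, _, hsup⟩, _⟩ := huk k hk
    exact lower_bound H hH3c _ (isBounded_ball.isCompact_closure) (uk k) u hc hsup Lip' hulip
      husol.1 x hx
  have hK : 0 < C₁ + M := by linarith
  have hL : (0 : ℝ) ≤ Lip' := Lip'.2
  obtain ⟨C, hC, hHC⟩ := hH3c (2 * Lip' + 2 * (C₁ + M)) (by positivity)
  have hmain : ∀ k : ℕ, 2 ≤ k → ∀ x ∈ ball (0 : Euc n) (k : ℝ),
        0 ≤ uk k x - u x ∧
          uk k x - u x ≤ ((C₁ + M) * (1 + C ^ 2)) * (1 + ‖x‖ ^ 2) / (k : ℝ) ^ 2 := by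
    intro k hk x hx
    have hk1 : 1 ≤ k := by omega
    have hkr : (1 : ℝ) ≤ k := by exact_mod_cast hk1
    have hk0 : (k : ℝ) ≠ 0 := by positivity
    refine ⟨sub_nonneg.2 (hlow k hk1 x (subset_closure hx)), ?_⟩
    obtain ⟨⟨hc, hsub, _⟩, hlip⟩ := huk k hk1
    rw [closure_ball _ hk0] at hc hlip
    have hvC := upper_const H C₁ hH1 k (by linarith) (uk k) hc Lip hlip hsub
    have h := upper_bound H C hC M (C₁ + M) hK C₁ le_rfl u hubd Lip' hulip hHC husol.2 k hkr
      (uk k) hc hvC hsub x (ball_subset_closedBall hx)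
    refine h.trans ?_
    rw [← mul_add, div_mul_eq_mul_div]
    gcongr ?_ / _
    rw [mul_assoc]
    gcongr
    nlinarith [mul_nonneg (sq_nonneg C) (sq_nonneg ‖x‖)]
  refine ⟨hlow, (C₁ + M) * (1 + C ^ 2), by positivity, hmain, ?_⟩
  intro R hR k hk hRk x hx
  obtain ⟨h1, h2⟩ := hmain k hk x (mem_ball_zero_iff.2 (by linarith))
  refine ⟨h1, h2.trans ?_⟩
  gcongr
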